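/- Define (I − Aᵗ) : ⊕_𝒢 ℤ → 𝔯̃_A on the group ⊕_𝒢 ℤ of finitely supported functions v : 𝒢 → ℤ by (I − Aᵗ)(v) := Σ_{x∈𝒢} v(x)·(δ_x − ρ_x) ∈ ℤ^𝒢. Then: (i) the map sending v to the family (v(x)·1_{Δ_x})_{x∈𝒢} ∈ ⊕_{x∈𝒢} C(Δ_x; ℤ) restricts to a group isomorphism from ker(I − Aᵗ) onto ker L_α := {f ∈ ⊕_{x∈𝒢} C(Δ_x; ℤ) : L_α f = 0}; (ii) the quotient groups C(Ω̃_A; ℤ) / im L_α and 𝔯̃_A / im(I − Aᵗ) are isomorphic, where C(Ω̃_A; ℤ) denotes the additive group of continuous integer-valued functions on Ω̃_A. -/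

import Mathlib

open OnePoint

noncomputable section

namespace CKO

variable {G : Type*}

/-- The submonoid `𝔽⁺` of the free group generated by the generators. -/
def pos (G : Type*) : Submonoid (FreeGroup G) :=
  Submonoid.closure (Set.range (FreeGroup.of : G → FreeGroup G))

/-- The defining relations of `Ω_A^τ` for a subset `ξ ⊆ 𝔽`, identified with a point of
`{0,1}^𝔽`: (a) `e ∈ ξ` and `ξ` contains every initial subword (prefix of the reduced word) of
each of its elements; (b) each `ω ∈ ξ` has at most one `y ∈ G` with `ωy ∈ ξ`; (c) if
`ω, ωy ∈ ξ` then `ωx⁻¹ ∈ ξ ↔ A(x,y) = 1`. -/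
def IsCK [DecidableEq G] (A : G → G → Bool) (ξ : FreeGroup G → Bool) : Prop :=
  ξ 1 = true ∧
  (∀ ω : FreeGroup G, ξ ω = true → ∀ p : List (G × Bool), p <+: ω.toWord →
    ξ (FreeGroup.mk p) = true) ∧
  (∀ ω : FreeGroup G, ξ ω = true → ∀ y z : G,
    ξ (ω * FreeGroup.of y) = true → ξ (ω * FreeGroup.of z) = true → y = z) ∧
  (∀ ω : FreeGroup G, ξ ω = true → ∀ y : G, ξ (ω * FreeGroup.of y) = true →
    ∀ x : G, (ξ (ω * (FreeGroup.of x)⁻¹) = true ↔ A x y = true))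

/-- `ξ` is unbounded: it has no upper bound in `𝔽` for the left order `s ≤ t ↔ s⁻¹t ∈ 𝔽⁺`. -/
def Unbounded (ξ : FreeGroup G → Bool) : Prop :=
  ¬ ∃ t : FreeGroup G, ∀ s : FreeGroup G, ξ s = true → s⁻¹ * t ∈ pos G

/-- `Ω̃_A`: the closure in `{0,1}^𝔽` of the set of unbounded elements of `Ω_A^τ`. -/
def OmegaT [DecidableEq G] (A : G → G → Bool) : Set (FreeGroup G → Bool) :=
  closure {ξ | IsCK A ξ ∧ Unbounded ξ}

end CKO

namespace CKO

variable {G : Type*} [DecidableEq G]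

/-- Membership in `⊕_{x∈G} C(Δ_x; ℤ)`: finitely many nonzero components, each vanishing
outside `Δ_x` and restricting to a continuous function on `Ω̃_A`. -/
def MemDirectSum (A : G → G → Bool) (f : G → (FreeGroup G → Bool) → ℤ) : Prop :=
  {x : G | f x ≠ 0}.Finite ∧
  (∀ (x : G) (ξ : FreeGroup G → Bool),
    (ξ ∉ OmegaT A ∨ ξ (FreeGroup.of x) ≠ true) → f x ξ = 0) ∧
  (∀ x : G, Continuous fun ξ : OmegaT A => f x (ξ : FreeGroup G → Bool))

/-- The map `L_α`: `(L_α f)(ξ) = Σ_x f_x(ξ) − Σ_{x : x⁻¹ ∈ ξ} f_x(xξ)`. -/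
def Lalpha (f : G → (FreeGroup G → Bool) → ℤ) (ξ : FreeGroup G → Bool) : ℤ :=
  (∑ᶠ x : G, f x ξ) -
    ∑ᶠ x : G, if ξ ((FreeGroup.of x)⁻¹) = true
      then f x fun ω => ξ ((FreeGroup.of x)⁻¹ * ω) else 0

/-- The ring `ℜ` of functions on `Ω̃_A` generated by `1` and the characteristic functions of
the `Δ_i` and `Δ_{i⁻¹}`. -/
def frakR (A : G → G → Bool) : Subring (OmegaT A → ℤ) :=
  Subring.closure
    ((Set.range fun i : G => fun ξ : OmegaT A =>
        if (ξ : FreeGroup G → Bool) (FreeGroup.of i) = true then (1 : ℤ) else 0) ∪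
     (Set.range fun i : G => fun ξ : OmegaT A =>
        if (ξ : FreeGroup G → Bool) ((FreeGroup.of i)⁻¹) = true then (1 : ℤ) else 0))

end CKO

namespace CKO

open scoped Classical

variable {G : Type*}

/-- The `i`-th row of `A` as an integer-valued function. -/
def rhoZ (A : G → G → Bool) (i : G) : G → ℤ := fun j => if A i j then 1 else 0

/-- The `i`-th row of the identity matrix as an integer-valued function. -/
def delZ [DecidableEq G] (i : G) : G → ℤ := fun j => if j = i then 1 else 0

/-- `𝔯̃_A`, the subring of `ℤ^G` generated by the rows of `A` and of the identity matrix
together with the constant function `1`. -/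
def frakRtA [DecidableEq G] (A : G → G → Bool) : Subring (G → ℤ) :=
  Subring.closure (Set.range (rhoZ A) ∪ Set.range (delZ (G := G)))

/-- The map `(I - Aᵗ) : ⊕_G ℤ → ℤ^G`, `v ↦ Σ_x v(x)·(δ_x − ρ_x)`. -/
def IA (A : G → G → Bool) (v : G →₀ ℤ) : G → ℤ :=
  fun j => v j - v.sum fun x n => n * (if A x j = true then 1 else 0)

/-- The embedding `v ↦ (v(x)·1_{Δ_x})_{x∈G}` of `⊕_G ℤ` into `⊕_{x∈G} C(Δ_x; ℤ)`. -/
def J [DecidableEq G] (A : G → G → Bool) (v : G →₀ ℤ) :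
    G → (FreeGroup G → Bool) → ℤ :=
  fun x ξ => if ξ ∈ OmegaT A ∧ ξ (FreeGroup.of x) = true then v x else 0

end CKO


namespace CKO

section Aux

set_option linter.unusedSectionVars false

variable {G : Type*}

/-- Infinite admissible paths. -/
def X (A : G → G → Bool) := {p : ℕ → G // ∀ n, A (p n) (p (n + 1)) = true}

variable {A : G → G → Bool}

def X.hd (p : X A) : G := p.1 0

def X.tl (p : X A) : X A := ⟨fun n => p.1 (n + 1), fun n => p.2 (n + 1)⟩

def X.cons (x : G) (p : X A) (h : A x p.hd = true) : X A :=
  ⟨fun n => Nat.casesOn n x p.1, fun n => by cases n with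
    | zero => exact h
    | succ n => exact p.2 n⟩

theorem X.hd_cons (x : G) (p : X A) (h) : (X.cons x p h).hd = x := rfl
theorem X.tl_cons (x : G) (p : X A) (h) : (X.cons x p h).tl = p := rfl
theorem X.hd_tl (p : X A) : A p.hd p.tl.hd = true := p.2 0
theorem X.cons_hd_tl (p : X A) (h) : X.cons p.hd p.tl h = p := by
  apply Subtype.ext; funext n; cases n <;> rfl

variable [DecidableEq G]

def step (p : X A) (s : G × Bool) : Option (X A) :=
  if s.2 = true then (if p.hd = s.1 then Option.some p.tl else none)
  else (if h : A s.1 p.hd = true then Option.some (X.cons s.1 p h) else none)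

def run : List (G × Bool) → X A → Option (X A)
  | [], p => Option.some p
  | s :: w, p => (step p s).bind (run w)

theorem step_inv {p q : X A} {s : G × Bool} (h : step p s = Option.some q) :
    step q (s.1, !s.2) = Option.some p := by
  obtain ⟨x, b⟩ := s
  cases b
  · simp only [step] at h ⊢
    simp only [Bool.false_eq_true, if_false] at h
    split_ifs at h with h1
    simp only [Option.some.injEq] at h
    subst h
    simp [X.hd_cons, X.tl_cons]
  · simp only [step] at h ⊢
    simp only [if_true] at h
    split_ifs at h with h1
    simp only [Option.some.injEq] at h
    subst h
    subst h1
    simp [X.hd_tl, X.cons_hd_tl]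

theorem run_append (w w' : List (G × Bool)) (p : X A) :
    run (w ++ w') p = (run w p).bind (run w') := by
  induction w generalizing p with
  | nil => rfl
  | cons s w ih =>
    simp only [List.cons_append, run]
    cases step p s with
    | none => rfl
    | some q => simp [ih]

theorem run_single (s : G × Bool) (p : X A) : run [s] p = step p s := by
  simp only [run]
  cases step p s <;> rfl

theorem run_redstep {w w' : List (G × Bool)} (h : FreeGroup.Red.Step w w') {p q : X A}
    (hr : run w p = Option.some q) : run w' p = Option.some q := by
  cases h with
  | @not L1 L2 x b =>
    rw [run_append] at hr ⊢
    cases h1 : run L1 p with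
    | none => simp [h1] at hr
    | some r =>
      simp only [h1, Option.bind_some, run] at hr ⊢
      cases h2 : step r (x, b) with
      | none => simp [h2] at hr
      | some r' =>
        have := step_inv h2
        simp only at this
        simpa [h2, this] using hr

theorem run_red {w w' : List (G × Bool)} (h : FreeGroup.Red w w') {p q : X A}
    (hr : run w p = Option.some q) : run w' p = Option.some q := by
  induction h with
  | refl => exact hr
  | tail _ h2 ih => exact run_redstep h2 ih

theorem run_inv {w : List (G × Bool)} {p q : X A} (h : run w p = Option.some q) :
    run (FreeGroup.invRev w) q = Option.some p := by
  induction w generalizing p with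
  | nil => simpa [run, eq_comm] using h
  | cons s w ih =>
    simp only [run] at h
    cases h2 : step p s with
    | none => simp [h2] at h
    | some r =>
      rw [h2] at h
      have h3 := ih h
      have : FreeGroup.invRev (s :: w) = FreeGroup.invRev w ++ [(s.1, !s.2)] := by
        simp [FreeGroup.invRev]
      rw [this, run_append, h3, Option.bind_some, run_single]
      exact step_inv h2

def D (ω : FreeGroup G) (p q : X A) : Prop := run ω.toWord p = Option.some q

theorem D_of_run {w : List (G × Bool)} {p q : X A} (h : run w p = Option.some q) :
    D (FreeGroup.mk w) p q := by
  unfold D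
  rw [FreeGroup.toWord_mk]
  exact run_red FreeGroup.reduce.red h

theorem D_one (p : X A) : D 1 p p := by simp [D, run]

theorem D_mul {a b : FreeGroup G} {p q r : X A} (h : D a p q) (h' : D b q r) :
    D (a * b) p r := by
  have : run (a.toWord ++ b.toWord) p = Option.some r := by
    rw [run_append, h]; exact h'
  have := D_of_run this
  rwa [← FreeGroup.mul_mk, FreeGroup.mk_toWord, FreeGroup.mk_toWord] at this

theorem D_inv {a : FreeGroup G} {p q : X A} (h : D a p q) : D a⁻¹ q p := by
  have := D_of_run (run_inv h)
  rwa [← FreeGroup.inv_mk, FreeGroup.mk_toWord] at this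

theorem D_of {y : G} {p q : X A} : D (FreeGroup.of y) p q ↔ p.hd = y ∧ q = p.tl := by
  unfold D
  rw [FreeGroup.toWord_of, run_single]
  simp [step, eq_comm]

theorem D_of_inv {x : G} {p q : X A} :
    D (FreeGroup.of x)⁻¹ p q ↔ ∃ h : A x p.hd = true, q = X.cons x p h := by
  unfold D
  have : ((FreeGroup.of x)⁻¹).toWord = [(x, false)] := by
    rw [FreeGroup.toWord_inv, FreeGroup.toWord_of]; rfl
  rw [this, run_single]
  simp only [step, Bool.false_eq_true, if_false]
  by_cases h : A x p.hd = true
  · simp [h, eq_comm]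
  · simp [h]

theorem D_cancel {a b : FreeGroup G} {p q r : X A} (h : D a p q) (h' : D (a * b) p r) :
    D b q r := by
  have := D_mul (D_inv h) h'
  simpa using this

/-- The configuration of a path. -/
def xi (p : X A) : FreeGroup G → Bool := fun ω => (run ω.toWord p).isSome

theorem xi_iff {p : X A} {ω : FreeGroup G} : xi p ω = true ↔ ∃ q, D ω p q := by
  simp [xi, D, Option.isSome_iff_exists]

theorem xi_mul {p q : X A} {a b : FreeGroup G} (h : D a p q) : xi p (a * b) = xi q b := by
  rw [Bool.eq_iff_iff, xi_iff, xi_iff]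
  constructor
  · rintro ⟨r, hr⟩; exact ⟨r, D_cancel h hr⟩
  · rintro ⟨r, hr⟩; exact ⟨r, D_mul h hr⟩

theorem xi_of {p : X A} {y : G} : xi p (FreeGroup.of y) = true ↔ p.hd = y := by
  rw [xi_iff]; simp [D_of]

theorem xi_of_inv {p : X A} {x : G} : xi p (FreeGroup.of x)⁻¹ = true ↔ A x p.hd = true := by
  rw [xi_iff]; simp [D_of_inv]

theorem xi_shift {p : X A} {x : G} (h : A x p.hd = true) :
    (fun ω => xi p ((FreeGroup.of x)⁻¹ * ω)) = xi (X.cons x p h) := by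
  funext ω
  exact xi_mul (D_of_inv.2 ⟨h, rfl⟩)

theorem xi_isCK (p : X A) : IsCK A (xi p) := by
  refine ⟨xi_iff.2 ⟨p, D_one p⟩, ?_, ?_, ?_⟩
  · rintro ω hω w ⟨w', hw⟩
    obtain ⟨q, hq⟩ := xi_iff.1 hω
    unfold D at hq
    rw [← hw, run_append] at hq
    cases h1 : run w p with
    | none => simp [h1] at hq
    | some r => exact xi_iff.2 ⟨r, D_of_run h1⟩
  · intro ω hω y z hy hz
    obtain ⟨q, hq⟩ := xi_iff.1 hω
    rw [xi_mul hq, xi_of] at hy hz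
    rw [← hy, hz]
  · intro ω hω y hy x
    obtain ⟨q, hq⟩ := xi_iff.1 hω
    rw [xi_mul hq, xi_of] at hy
    rw [xi_mul hq, xi_of_inv, hy]

def pre : ℕ → X A → FreeGroup G
  | 0, _ => 1
  | n + 1, p => FreeGroup.of p.hd * pre n p.tl

theorem xi_pre (n : ℕ) (p : X A) : xi p (pre n p) = true := by
  induction n generalizing p with
  | zero => exact xi_iff.2 ⟨p, D_one p⟩
  | succ n ih =>
    rw [pre, xi_mul (q := p.tl) (D_of.2 ⟨rfl, rfl⟩)]
    exact ih _

def deg : FreeGroup G →* Multiplicative ℤ := FreeGroup.lift fun _ => Multiplicative.ofAdd 1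

theorem deg_pre (n : ℕ) (p : X A) : (deg (pre n p)).toAdd = n := by
  induction n generalizing p with
  | zero => simp [pre]
  | succ n ih =>
    rw [pre, map_mul, toAdd_mul, ih]
    simp [deg]; ring

theorem deg_pos {t : FreeGroup G} (h : t ∈ pos G) : 0 ≤ (deg t).toAdd := by
  induction h using Submonoid.closure_induction with
  | mem x hx => obtain ⟨y, rfl⟩ := hx; simp [deg]
  | one => simp
  | mul x y _ _ hx hy => rw [map_mul, toAdd_mul]; omega

theorem xi_unbounded (p : X A) : Unbounded (xi p) := by
  rintro ⟨t, ht⟩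
  have key : ∀ n : ℕ, (n : ℤ) ≤ (deg t).toAdd := by
    intro n
    have := deg_pos (ht _ (xi_pre n p))
    rw [map_mul, map_inv, toAdd_mul, toAdd_inv, deg_pre] at this
    omega
  have := key ((deg t).toAdd.toNat + 1)
  push_cast at this
  omega

/-- Invariant. -/
def Inv (ξ : FreeGroup G → Bool) (ω : FreeGroup G) (q : X A) : Prop :=
  ∀ n, ξ (ω * pre n q) = true

theorem Inv.mem {ξ : FreeGroup G → Bool} {ω : FreeGroup G} {q : X A} (h : Inv ξ ω q) :
    ξ ω = true := by simpa [pre] using h 0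

theorem Inv.next {ξ : FreeGroup G → Bool} {ω : FreeGroup G} {q : X A} (h : Inv ξ ω q) :
    ξ (ω * FreeGroup.of q.hd) = true := by simpa [pre] using h 1

theorem Inv.step {ξ : FreeGroup G → Bool} (hξ : IsCK A ξ) {ω : FreeGroup G} {q r : X A}
    (h : Inv ξ ω q) {s : G × Bool} (hs : step q s = Option.some r) : Inv ξ (ω * FreeGroup.mk [s]) r := by
  obtain ⟨x, b⟩ := s
  cases b
  · have h1 : FreeGroup.mk [(x, false)] = (FreeGroup.of x)⁻¹ := rfl
    rw [← run_single] at hs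
    have h2 := D_of_run hs
    rw [h1] at h2 ⊢
    obtain ⟨h3, rfl⟩ := D_of_inv.1 h2
    intro n
    cases n with
    | zero =>
      simp only [pre, mul_one]
      exact (hξ.2.2.2 ω h.mem _ h.next x).2 h3
    | succ n =>
      simp only [pre, X.hd_cons, X.tl_cons]
      simpa [mul_assoc] using h n
  · have h1 : FreeGroup.mk [(x, true)] = FreeGroup.of x := rfl
    rw [← run_single] at hs
    have h2 := D_of_run hs
    rw [h1] at h2 ⊢
    obtain ⟨rfl, rfl⟩ := D_of.1 h2
    intro n
    have := h (n + 1)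
    simpa [pre, mul_assoc] using this

theorem eq_xi_of_inv {ξ : FreeGroup G → Bool} (hξ : IsCK A ξ) {p : X A} (hp : Inv ξ 1 p) :
    ξ = xi p := by
  have back : ∀ (w : List (G × Bool)) (q : X A), run w p = Option.some q → Inv ξ (FreeGroup.mk w) q := by
    intro w
    induction w using List.reverseRecOn with
    | nil =>
      intro q hq
      simp only [run, Option.some.injEq] at hq
      subst hq
      simpa [← FreeGroup.one_eq_mk] using hp
    | append_singleton w s ih =>
      intro q hq
      rw [run_append] at hq
      cases h1 : run w p with
      | none => simp [h1] at hq
      | some r =>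
        rw [h1, Option.bind_some, run_single] at hq
        rw [← FreeGroup.mul_mk]
        exact (ih r h1).step hξ hq
  have fwd : ∀ (w : List (G × Bool)), (∀ w', w' <+: w → ξ (FreeGroup.mk w') = true) →
      ∃ q, run w p = Option.some q := by
    intro w
    induction w using List.reverseRecOn with
    | nil => intro _; exact ⟨p, rfl⟩
    | append_singleton w s ih =>
      intro hw
      obtain ⟨q, hq⟩ := ih fun w' hw' => hw w' (hw'.trans (List.prefix_append _ _))
      have hI := back w q hq
      have hws := hw _ (List.prefix_refl _)
      rw [← FreeGroup.mul_mk] at hws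
      obtain ⟨x, b⟩ := s
      rw [run_append, hq, Option.bind_some, run_single]
      cases b
      · have h1 : FreeGroup.mk [(x, false)] = (FreeGroup.of x)⁻¹ := rfl
        rw [h1] at hws
        have := (hξ.2.2.2 _ hI.mem _ hI.next x).1 hws
        simp [step, this]
      · have h1 : FreeGroup.mk [(x, true)] = FreeGroup.of x := rfl
        rw [h1] at hws
        have := hξ.2.2.1 _ hI.mem _ _ hI.next hws
        simp [step, this]
  funext ω
  rw [Bool.eq_iff_iff, xi_iff]
  constructor
  · intro h
    exact fwd _ (hξ.2.1 ω h)
  · rintro ⟨q, hq⟩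
    have := (back _ q hq).mem
    rwa [FreeGroup.mk_toWord] at this

def lprod (L : List G) : FreeGroup G := (L.map FreeGroup.of).prod

theorem lprod_pos (L : List G) : lprod L ∈ pos G := by
  apply Submonoid.list_prod_mem
  intro x hx
  obtain ⟨y, _, rfl⟩ := List.mem_map.1 hx
  exact Submonoid.subset_closure ⟨y, rfl⟩

theorem exists_next {ξ : FreeGroup G → Bool} (hξ : IsCK A ξ) (hu : Unbounded ξ) (L : List G)
    (hL : ∀ L', L' <+: L → ξ (lprod L') = true) : ∃ y, ξ (lprod L * FreeGroup.of y) = true := by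
  by_contra hcon
  push Not at hcon
  apply hu
  refine ⟨lprod L, ?_⟩
  have key : ∀ (w : List (G × Bool)), (∀ w', w' <+: w → ξ (FreeGroup.mk w') = true) →
      ∃ M : List G, FreeGroup.mk w * lprod M = lprod L ∧
        ∀ M', M' <+: M → ξ (FreeGroup.mk w * lprod M') = true := by
    intro w
    induction w using List.reverseRecOn with
    | nil =>
      intro _
      refine ⟨L, ?_, ?_⟩
      · rw [← FreeGroup.one_eq_mk, one_mul]
      · intro M' hM'
        rw [← FreeGroup.one_eq_mk, one_mul]
        exact hL _ hM'
    | append_singleton w s ih =>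
      intro hw
      obtain ⟨M, hM, hM'⟩ := ih fun w' hw' => hw w' (hw'.trans (List.prefix_append _ _))
      have hws := hw _ (List.prefix_refl _)
      rw [← FreeGroup.mul_mk] at hws ⊢
      have hw0 := hw w (List.prefix_append _ _)
      obtain ⟨x, b⟩ := s
      cases b
      · have h1 : FreeGroup.mk [(x, false)] = (FreeGroup.of x)⁻¹ := rfl
        rw [h1] at hws ⊢
        refine ⟨x :: M, ?_, ?_⟩
        · rw [← hM]; simp [lprod, mul_assoc]
        · intro M' hMM
          cases M' with
          | nil => simpa [lprod] using hws
          | cons z M' =>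
            obtain ⟨rfl, h3⟩ := List.cons_prefix_cons.1 hMM
            simpa [lprod, mul_assoc] using hM' _ h3
      · have h1 : FreeGroup.mk [(x, true)] = FreeGroup.of x := rfl
        rw [h1] at hws ⊢
        cases M with
        | nil =>
          exfalso
          apply hcon x
          rw [← hM]
          simpa [lprod] using hws
        | cons z M =>
          have h2 := hM' [z] (by simp)
          simp only [lprod, List.map_cons, List.map_nil, List.prod_cons, List.prod_nil,
            mul_one] at h2
          have := hξ.2.2.1 _ hw0 _ _ h2 hws
          subst this
          refine ⟨M, ?_, ?_⟩
          · rw [← hM]; simp [lprod, mul_assoc]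
          · intro M' h3
            have := hM' (z :: M') (List.cons_prefix_cons.2 ⟨rfl, h3⟩)
            simpa [lprod, mul_assoc] using this
  intro s hs
  obtain ⟨M, hM, _⟩ := key s.toWord (hξ.2.1 s hs)
  rw [FreeGroup.mk_toWord] at hM
  rw [← hM]
  simpa using lprod_pos M

theorem exists_path {ξ : FreeGroup G → Bool} (hξ : IsCK A ξ) (hu : Unbounded ξ) :
    ∃ p : X A, ξ = xi p := by
  let T := {L : List G // ∀ L', L' <+: L → ξ (lprod L') = true}
  have hn : ∀ L : T, ∃ y, ξ (lprod L.1 * FreeGroup.of y) = true :=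
    fun L => exists_next hξ hu L.1 L.2
  choose nx hnx using hn
  have hlast : ∀ (L : List G) (y : G), lprod (L ++ [y]) = lprod L * FreeGroup.of y := by
    intro L y; simp [lprod]
  let nxt : T → T := fun L => ⟨L.1 ++ [nx L], by
    intro L' hL'
    rcases List.prefix_concat_iff.1 (by simpa using hL') with h | h
    · rw [h]; simpa [hlast] using hnx L
    · exact L.2 _ h⟩
  have hnil : ξ (lprod []) = true := by simpa [lprod] using hξ.1
  let S : ℕ → T := fun n => Nat.rec ⟨[], by
    intro L' hL'; rw [List.prefix_nil.1 hL']; exact hnil⟩ (fun _ L => nxt L) n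
  have hS : ∀ n, (S (n + 1)).1 = (S n).1 ++ [nx (S n)] := fun n => rfl
  have hmem : ∀ n, ξ (lprod (S n).1) = true := fun n => (S n).2 _ (List.prefix_refl _)
  let p : X A := ⟨fun n => nx (S n), by
    intro n
    have h1 := hnx (S (n + 1))
    rw [← hξ.2.2.2 _ (hmem (n + 1)) _ h1]
    rw [hS, hlast, mul_inv_cancel_right]
    exact hmem n⟩
  refine ⟨p, eq_xi_of_inv hξ ?_⟩
  have key : ∀ (n k : ℕ) (q : X A), (∀ i, q.1 i = nx (S (k + i))) →
      lprod (S k).1 * pre n q = lprod (S (k + n)).1 := by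
    intro n
    induction n with
    | zero => intro k q _; simp [pre]
    | succ n ih =>
      intro k q hq
      have h1 : q.hd = nx (S k) := hq 0
      have := ih (k + 1) q.tl (fun i => by
        have := hq (i + 1)
        rw [show k + 1 + i = k + (i + 1) by ring]
        exact this)
      rw [pre, h1, ← mul_assoc, ← hlast, ← hS, this, show k + 1 + n = k + (n + 1) by ring]
  intro n
  have := key n 0 p (fun i => by rw [Nat.zero_add])
  have h0 : lprod (S 0).1 = 1 := by change lprod [] = 1; simp [lprod]
  rw [h0] at this
  rw [this]
  exact hmem _

theorem OmegaT_eq : OmegaT A = closure (Set.range (xi : X A → _)) := by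
  unfold OmegaT
  congr 1
  ext ξ
  constructor
  · rintro ⟨h1, h2⟩
    obtain ⟨p, rfl⟩ := exists_path h1 h2
    exact ⟨p, rfl⟩
  · rintro ⟨p, rfl⟩
    exact ⟨xi_isCK p, xi_unbounded p⟩

theorem isClosed_OmegaT : IsClosed (OmegaT A) := isClosed_closure

def pt (p : X A) : OmegaT A := ⟨xi p, by rw [OmegaT_eq]; exact subset_closure ⟨p, rfl⟩⟩

theorem xi_mem (p : X A) : xi p ∈ OmegaT A := (pt p).2

theorem denseRange_pt : DenseRange (pt : X A → OmegaT A) := by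
  rintro ⟨ξ, hξ⟩
  rw [closure_subtype]
  have h1 : Subtype.val '' Set.range (pt : X A → OmegaT A) = Set.range (xi : X A → _) := by
    rw [← Set.range_comp]; rfl
  rw [h1, ← OmegaT_eq]
  exact hξ

theorem eq_of_dense {F F' : (FreeGroup G → Bool) → ℤ}
    (hF : Continuous fun ξ : OmegaT A => F ξ) (hF' : Continuous fun ξ : OmegaT A => F' ξ)
    (h : ∀ p : X A, F (xi p) = F' (xi p)) : ∀ ξ ∈ OmegaT A, F ξ = F' ξ := by
  intro ξ hξ
  exact congrFun (denseRange_pt.equalizer hF hF' (funext h)) ⟨ξ, hξ⟩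

def sh (a : FreeGroup G) (ξ : FreeGroup G → Bool) : FreeGroup G → Bool := fun ω => ξ (a * ω)

theorem continuous_sh (a : FreeGroup G) : Continuous (sh a) :=
  continuous_pi fun _ => continuous_apply _

theorem isClopen_coord (ω : FreeGroup G) :
    IsClopen {ξ : FreeGroup G → Bool | ξ ω = true} :=
  (isClopen_discrete {true}).preimage (continuous_apply ω)

theorem sh_mem {a : FreeGroup G} {ξ : FreeGroup G → Bool} (hξ : ξ ∈ OmegaT A)
    (hx : ξ a = true) : sh a ξ ∈ OmegaT A := by
  rw [OmegaT_eq] at hξ ⊢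
  have h1 : ξ ∈ closure ({ξ : FreeGroup G → Bool | ξ a = true} ∩
      Set.range (xi : X A → _)) := (isClopen_coord _).isOpen.inter_closure ⟨hx, hξ⟩
  refine map_mem_closure (continuous_sh a) h1 ?_
  rintro _ ⟨h2, p, rfl⟩
  obtain ⟨q, hq⟩ := xi_iff.1 h2
  exact ⟨q, funext fun ω => (xi_mul hq).symm⟩

theorem continuous_Lterm {a : FreeGroup G} {F : (FreeGroup G → Bool) → ℤ}
    (hF : Continuous fun ξ : OmegaT A => F ξ) :
    Continuous fun ξ : OmegaT A =>
      if ξ.1 a = true then F (sh a ξ.1) else 0 := by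
  have hc : IsClopen {ξ : OmegaT A | ξ.1 a = true} :=
    (isClopen_coord _).preimage continuous_subtype_val
  apply continuous_if
  · intro b ha
    rw [hc.frontier_eq] at ha
    exact ha.elim
  · rw [hc.isClosed.closure_eq, continuousOn_iff_continuous_domRestrict]
    have : Continuous fun ξ : {ξ : OmegaT A | ξ.1 a = true} =>
        (⟨sh a ξ.1.1, sh_mem ξ.1.2 ξ.2⟩ : OmegaT A) :=
      Continuous.subtype_mk ((continuous_sh a).comp
        (continuous_subtype_val.comp continuous_subtype_val)) _
    exact hF.comp this
  · exact continuousOn_const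

theorem Lalpha_eq {f : G → (FreeGroup G → Bool) → ℤ} (s : Finset G)
    (hs : ∀ x, f x ≠ 0 → x ∈ s) (ξ : FreeGroup G → Bool) :
    Lalpha f ξ = ∑ x ∈ s, (f x ξ - if ξ (FreeGroup.of x)⁻¹ = true then f x (sh (FreeGroup.of x)⁻¹ ξ) else 0) := by
  unfold Lalpha
  rw [Finset.sum_sub_distrib, finsum_eq_sum_of_support_subset, finsum_eq_sum_of_support_subset]
  · rfl
  · intro x hx
    apply hs
    rintro h
    apply hx
    simp [h]
  · intro x hx
    apply hs
    rintro h
    apply hx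
    simp [h]

theorem continuous_Lalpha {f : G → (FreeGroup G → Bool) → ℤ} (hf : MemDirectSum A f) :
    Continuous fun ξ : OmegaT A => Lalpha f ξ := by
  have : (fun ξ : OmegaT A => Lalpha f ξ.1) = fun ξ : OmegaT A => ∑ x ∈ hf.1.toFinset,
      (f x ξ.1 - if ξ.1 (FreeGroup.of x)⁻¹ = true then f x (sh (FreeGroup.of x)⁻¹ ξ.1) else 0) :=
    funext fun ξ => Lalpha_eq _ (by simp) _
  rw [this]
  exact continuous_finsetSum _ fun x _ => (hf.2.2 x).sub (continuous_Lterm (hf.2.2 x))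

theorem Lalpha_xi {f : G → (FreeGroup G → Bool) → ℤ} (hf : MemDirectSum A f) (p : X A) :
    Lalpha f (xi p) = f p.hd (xi p) -
      ∑ᶠ x, if h : A x p.hd = true then f x (xi (X.cons x p h)) else 0 := by
  unfold Lalpha
  congr 1
  · apply finsum_eq_single
    intro x hx
    apply hf.2.1
    right
    rw [Ne, xi_of]
    exact fun h => hx h.symm
  · apply finsum_congr
    intro x
    by_cases h : A x p.hd = true
    · rw [if_pos (xi_of_inv.2 h), dif_pos h, xi_shift h]
    · rw [if_neg (fun h' => h (xi_of_inv.1 h')), dif_neg h]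

theorem exists_dep {F : (FreeGroup G → Bool) → ℤ} (hF : Continuous fun ξ : OmegaT A => F ξ) :
    ∃ s : Finset (FreeGroup G), ∀ ξ ∈ OmegaT A, ∀ η ∈ OmegaT A,
      (∀ ω ∈ s, ξ ω = η ω) → F ξ = F η := by
  classical
  have hloc : ∀ ξ ∈ OmegaT A, ∃ s : Finset (FreeGroup G), ∀ η ∈ OmegaT A,
      (∀ ω ∈ s, ξ ω = η ω) → F ξ = F η := by
    intro ξ hξ
    have h1 : {η : OmegaT A | F η = F ξ} ∈ nhds (⟨ξ, hξ⟩ : OmegaT A) :=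
      hF.continuousAt.preimage_mem_nhds
        ((isOpen_discrete {F ξ}).mem_nhds (Set.mem_singleton _))
    rw [mem_nhds_subtype] at h1
    obtain ⟨u, hu, hu'⟩ := h1
    rw [nhds_pi, Filter.mem_pi] at hu
    obtain ⟨I, hI, t, ht, htu⟩ := hu
    refine ⟨hI.toFinset, fun η hη hag => ?_⟩
    have : η ∈ u := htu fun ω hω => by
      rw [← hag ω (by simpa using hω)]
      exact mem_of_mem_nhds (ht ω)
    exact (hu' (show (⟨η, hη⟩ : OmegaT A) ∈ _ from this)).symm
  choose! s hs using hloc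
  let V : (FreeGroup G → Bool) → Set (FreeGroup G → Bool) :=
    fun ξ => {η | ∀ ω ∈ s ξ, ξ ω = η ω}
  have hV : ∀ ξ, IsOpen (V ξ) := by
    intro ξ
    have : V ξ = ⋂ ω ∈ s ξ, {η | ξ ω = η ω} := by ext; simp [V]
    rw [this]
    refine isOpen_biInter_finset fun ω _ => ?_
    exact (isOpen_discrete {b | ξ ω = b}).preimage (continuous_apply ω)
  obtain ⟨t, ht1, ht2⟩ := (isClosed_OmegaT (A := A)).isCompact.elim_nhds_subcover V
    (fun ξ _ => (hV ξ).mem_nhds fun _ _ => rfl)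
  refine ⟨t.biUnion s, fun ξ hξ η hη hag => ?_⟩
  obtain ⟨ζ, hζ, hζ'⟩ := Set.mem_iUnion₂.1 (ht2 hξ)
  rw [← hs ζ (ht1 ζ hζ) ξ hξ hζ', ← hs ζ (ht1 ζ hζ) η hη]
  intro ω hω
  rw [hζ' ω hω]
  exact hag ω (Finset.mem_biUnion.2 ⟨ζ, hζ, hω⟩)

theorem run_dep (w : List (G × Bool)) (p q : X A) (h : ∀ i ≤ w.length, p.1 i = q.1 i) :
    (run w p).isSome = (run w q).isSome := by
  induction w generalizing p q with
  | nil => rfl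
  | cons s w ih =>
    have h0 : p.hd = q.hd := h 0 (Nat.zero_le _)
    obtain ⟨x, b⟩ := s
    simp only [run, step]
    cases b
    · simp only [Bool.false_eq_true, if_false]
      by_cases h1 : A x q.hd = true
      · have h2 : A x p.hd = true := by rw [h0]; exact h1
        rw [dif_pos h1, dif_pos h2, Option.bind_some, Option.bind_some]
        refine ih _ _ fun i hi => ?_
        cases i with
        | zero => rfl
        | succ i => exact h i (by simp at hi ⊢; omega)
      · have h2 : ¬ A x p.hd = true := by rw [h0]; exact h1
        rw [dif_neg h1, dif_neg h2]
    · simp only [if_true]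
      rw [h0]
      by_cases h1 : q.hd = x
      · simp only [h1, if_true, Option.bind_some]
        refine ih _ _ fun i hi => h (i + 1) (by simp; omega)
      · simp [h1]

theorem exists_dep_nat {F : (FreeGroup G → Bool) → ℤ}
    (hF : Continuous fun ξ : OmegaT A => F ξ) :
    ∃ n : ℕ, ∀ p q : X A, (∀ i ≤ n, p.1 i = q.1 i) → F (xi p) = F (xi q) := by
  obtain ⟨s, hs⟩ := exists_dep hF
  refine ⟨s.sup fun ω => ω.toWord.length, fun p q h => hs _ (xi_mem p) _ (xi_mem q) ?_⟩
  intro ω hω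
  exact run_dep _ _ _ fun i hi => h i (hi.trans (Finset.le_sup (f := fun ω => ω.toWord.length) hω))

theorem memJ (v : G →₀ ℤ) : MemDirectSum A (J A v) := by
  refine ⟨?_, ?_, ?_⟩
  · refine v.hasFiniteSupport.subset fun x hx => ?_
    by_contra h
    apply hx
    funext ξ
    have : v x = 0 := by simpa using h
    simp [J, this]
  · rintro x ξ h
    unfold J
    rw [if_neg]
    rintro ⟨h1, h2⟩
    rcases h with h | h
    · exact h h1
    · exact h h2
  · intro x
    have hc : IsClopen {ξ : OmegaT A | ξ.1 (FreeGroup.of x) = true} :=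
      (isClopen_coord _).preimage continuous_subtype_val
    have : (fun ξ : OmegaT A => J A v x ξ.1) = fun ξ : OmegaT A =>
        if ξ.1 (FreeGroup.of x) = true then v x else 0 := by
      funext ξ
      simp [J]
    rw [this]
    apply continuous_if
    · intro a ha
      rw [hc.frontier_eq] at ha
      exact ha.elim
    · exact continuousOn_const
    · exact continuousOn_const

theorem J_xi (v : G →₀ ℤ) (x : G) (p : X A) : J A v x (xi p) = if p.hd = x then v x else 0 := by
  simp [J, xi_mem, xi_of]

theorem LJ_xi (v : G →₀ ℤ) (p : X A) : Lalpha (J A v) (xi p) = IA A v p.hd := by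
  rw [Lalpha_xi (memJ v), J_xi, if_pos rfl, IA]
  congr 1
  rw [Finsupp.sum, finsum_eq_sum_of_support_subset (s := v.support)]
  · apply Finset.sum_congr rfl
    intro x _
    by_cases h : A x p.hd = true
    · simp [h, J_xi, X.hd_cons]
    · simp [h]
  · intro x hx
    simp only [Finset.mem_coe, Finsupp.mem_support_iff]
    intro h0
    apply hx
    simp [J_xi, h0]

theorem exists_hd (hA : ∀ i : G, ∃ j : G, A i j = true) (j : G) : ∃ p : X A, p.hd = j := by
  choose n hn using hA
  refine ⟨⟨fun k => n^[k] j, fun k => ?_⟩, rfl⟩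
  simp only [Function.iterate_succ_apply']
  exact hn _

theorem keyK (hA : ∀ i : G, ∃ j : G, A i j = true)
    {f : G → (FreeGroup G → Bool) → ℤ} (hf : MemDirectSum A f) (g : G → ℤ)
    (h : ∀ p : X A, Lalpha f (xi p) = g p.hd) : ∃ v : G →₀ ℤ, f = J A v ∧ IA A v = g := by
  classical
  have hdep : ∀ n : ℕ, (∀ x (p q : X A), (∀ i ≤ n, p.1 i = q.1 i) → f x (xi p) = f x (xi q)) →
      ∀ x (p q : X A), (∀ i ≤ 0, p.1 i = q.1 i) → f x (xi p) = f x (xi q) := by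
    intro n
    induction n with
    | zero => exact fun h => h
    | succ n ih =>
      intro hn
      apply ih
      intro x p q hpq
      have h0 : p.hd = q.hd := hpq 0 (Nat.zero_le _)
      by_cases hx : p.hd = x
      · have hp := h p
        have hq := h q
        rw [Lalpha_xi hf] at hp hq
        rw [← hx]
        have : (∑ᶠ x, if h : A x p.hd = true then f x (xi (X.cons x p h)) else 0) =
            ∑ᶠ x, if h : A x q.hd = true then f x (xi (X.cons x q h)) else 0 := by
          apply finsum_congr
          intro z
          by_cases hz : A z p.hd = true
          · have hz' : A z q.hd = true := by rw [← h0]; exact hz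
            rw [dif_pos hz, dif_pos hz']
            apply hn
            intro i hi
            cases i with
            | zero => rfl
            | succ i => exact hpq i (by omega)
          · have hz' : ¬ A z q.hd = true := by rw [← h0]; exact hz
            rw [dif_neg hz, dif_neg hz']
        rw [this, h0] at hp
        rw [h0]
        linarith
      · rw [hf.2.1 x (xi p) (Or.inr (by rw [Ne, xi_of]; exact hx)),
          hf.2.1 x (xi q) (Or.inr (by rw [Ne, xi_of, ← h0]; exact hx))]
  choose N hN using fun x => exists_dep_nat (hf.2.2 x)
  have h0 := hdep (hf.1.toFinset.sup N) (by
    intro x p q hpq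
    by_cases hx : f x = 0
    · simp [hx]
    · exact hN x p q fun i hi => hpq i (hi.trans (Finset.le_sup (by simpa using hx))))
  choose P hP using exists_hd hA
  let v : G →₀ ℤ := Finsupp.onFinset hf.1.toFinset (fun x => f x (xi (P x))) (by
    intro x hx
    simp only [Set.Finite.mem_toFinset, Set.mem_ofPred_eq]
    intro h
    apply hx
    simp [h])
  have hv : ∀ x, v x = f x (xi (P x)) := fun x => rfl
  have hfJ : f = J A v := by
    funext x ξ
    by_cases hξ : ξ ∈ OmegaT A
    · revert ξ hξ
      apply eq_of_dense (hf.2.2 x) ((memJ v).2.2 x)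
      intro p
      rw [J_xi]
      split_ifs with hx
      · rw [hv]
        apply h0
        intro i hi
        obtain rfl : i = 0 := by omega
        exact hx.trans (hP x).symm
      · exact hf.2.1 x (xi p) (Or.inr (by rw [Ne, xi_of]; exact hx))
    · rw [hf.2.1 x ξ (Or.inl hξ), (memJ v).2.1 x ξ (Or.inl hξ)]
  refine ⟨v, hfJ, ?_⟩
  funext j
  have := h (P j)
  rw [hfJ, LJ_xi, hP] at this
  exact this

theorem J_injective (hA : ∀ i : G, ∃ j : G, A i j = true) {v w : G →₀ ℤ} (h : J A v = J A w) :
    v = w := by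
  ext x
  obtain ⟨p, hp⟩ := exists_hd hA x
  have := congrFun (congrFun h x) (xi p)
  simpa [J_xi, hp] using this

theorem IA_eq (v : G →₀ ℤ) : IA A v = v.sum fun x n => n • (delZ x - rhoZ A x) := by
  funext j
  simp only [IA, Finsupp.sum, Finset.sum_apply, Pi.smul_apply, Pi.sub_apply, smul_eq_mul, mul_sub,
    Finset.sum_sub_distrib, rhoZ, delZ]
  congr 1
  simp [Finset.sum_ite_eq]

theorem IA_mem (v : G →₀ ℤ) : IA A v ∈ frakRtA A := by
  rw [IA_eq]
  refine sum_mem fun x _ => zsmul_mem (sub_mem ?_ ?_) _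
  · exact Subring.subset_closure (Or.inr ⟨x, rfl⟩)
  · exact Subring.subset_closure (Or.inl ⟨x, rfl⟩)

theorem mem_closure_ind {Y I : Type*} (b : I → Y → Bool) (s : Finset I) :
    ∀ f : Y → ℤ, (∀ y z, (∀ i ∈ s, b i y = b i z) → f y = f z) →
      f ∈ Subring.closure (Set.range fun i => fun y => if b i y = true then (1 : ℤ) else 0) := by
  classical
  induction s using Finset.induction_on with
  | empty =>
    intro f hf
    by_cases hY : Nonempty Y
    · obtain ⟨y⟩ := hY
      have : f = (f y : Y → ℤ) := by
        funext z
        exact hf z y (by simp)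
      rw [this]
      exact intCast_mem _ _
    · have : f = 0 := by
        funext z
        exact (hY ⟨z⟩).elim
      rw [this]
      exact zero_mem _
  | insert a s _ ih =>
    intro f hf
    let E : (Y → Prop) → ℤ := fun P => if h : ∃ z, P z then f h.choose else 0
    let e : Bool → Y → ℤ := fun t y => E fun z => b a z = t ∧ ∀ i ∈ s, b i z = b i y
    have he : ∀ y, e (b a y) y = f y := by
      intro y
      have hex : ∃ z, b a z = b a y ∧ ∀ i ∈ s, b i z = b i y := ⟨y, rfl, fun _ _ => rfl⟩
      simp only [e, E]
      rw [dif_pos hex]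
      apply hf
      intro i hi
      rcases Finset.mem_insert.1 hi with rfl | hi
      · exact hex.choose_spec.1
      · exact hex.choose_spec.2 i hi
    have hed : ∀ t, e t ∈ Subring.closure
        (Set.range fun i => fun y => if b i y = true then (1 : ℤ) else 0) := by
      intro t
      apply ih
      intro y z hyz
      have : (fun u => b a u = t ∧ ∀ i ∈ s, b i u = b i y) =
          (fun u => b a u = t ∧ ∀ i ∈ s, b i u = b i z) := by
        funext u
        apply propext
        refine and_congr_right fun _ => forall₂_congr fun i hi => ?_
        rw [hyz i hi]
      exact congrArg E this
    have hfe : f = (fun y => if b a y = true then (1 : ℤ) else 0) * e true +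
        (1 - (fun y => if b a y = true then (1 : ℤ) else 0)) * e false := by
      funext y
      have := he y
      cases hb : b a y <;> simp [hb, ← this]
    rw [hfe]
    have ha := Subring.subset_closure (R := Y → ℤ)
      (s := Set.range fun i => fun y => if b i y = true then (1 : ℤ) else 0) ⟨a, rfl⟩
    exact add_mem (mul_mem ha (hed _)) (mul_mem (sub_mem (one_mem _) ha) (hed _))

def pull (A : G → G → Bool) : (G → ℤ) →+* (X A → ℤ) where
  toFun g p := g p.hd
  map_one' := rfl
  map_mul' _ _ := rfl
  map_zero' := rfl
  map_add' _ _ := rfl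

def shf (x : G) (h : X A → ℤ) : X A → ℤ := fun p => if p.hd = x then h p.tl else 0

inductive S (A : G → G → Bool) : (X A → ℤ) → Prop
  | pull (g : G → ℤ) (hg : g ∈ frakRtA A) : S A (CKO.pull A g)
  | add (h h' : X A → ℤ) : S A h → S A h' → S A (h + h')
  | shf (x : G) (h : X A → ℤ) : S A h → S A (CKO.shf x h)

theorem pull_shf (g : G → ℤ) (x : G) (h : X A → ℤ) :
    pull A g * shf x h = shf x (pull A (fun _ => g x) * h) := by
  funext p
  simp only [Pi.mul_apply, shf, pull, RingHom.coe_mk, MonoidHom.coe_mk, OneHom.coe_mk]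
  split_ifs with h1
  · rw [h1]
  · simp

theorem const_mem (k : ℤ) : (fun _ => k : G → ℤ) ∈ frakRtA A := by
  have : (fun _ => k : G → ℤ) = (k : G → ℤ) := rfl
  rw [this]
  exact intCast_mem _ _

theorem rho_mem (x : G) : rhoZ A x ∈ frakRtA A := Subring.subset_closure (Or.inl ⟨x, rfl⟩)

theorem S_zero : S A 0 := by
  have := S.pull (A := A) 0 (zero_mem _)
  rwa [map_zero] at this

theorem S_one : S A 1 := by
  have := S.pull (A := A) 1 (one_mem _)
  rwa [map_one] at this

theorem S_pull_mul {h : X A → ℤ} (hh : S A h) : ∀ g ∈ frakRtA A, S A (pull A g * h) := by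
  induction hh with
  | pull g' hg' =>
    intro g hg
    rw [← map_mul]
    exact S.pull _ (mul_mem hg hg')
  | add h h' _ _ ih ih' =>
    intro g hg
    rw [mul_add]
    exact S.add _ _ (ih g hg) (ih' g hg)
  | shf x h _ ih =>
    intro g hg
    rw [pull_shf]
    exact S.shf _ _ (ih _ (const_mem _))

theorem S_mul {h : X A → ℤ} (hh : S A h) : ∀ h', S A h' → S A (h * h') := by
  induction hh with
  | pull g hg => exact fun h' hh' => S_pull_mul hh' g hg
  | add h1 h2 _ _ ih1 ih2 =>
    intro h' hh'
    rw [add_mul]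
    exact S.add _ _ (ih1 _ hh') (ih2 _ hh')
  | shf x h hS ih =>
    intro h' hh'
    induction hh' with
    | pull g hg =>
      rw [mul_comm, pull_shf]
      exact S.shf _ _ (S_pull_mul hS _ (const_mem _))
    | add h1 h2 _ _ ih1 ih2 =>
      rw [mul_add]
      exact S.add _ _ ih1 ih2
    | shf y h' hS' _ =>
      by_cases hxy : x = y
      · subst hxy
        have : shf x h * shf x h' = shf x (h * h') := by
          funext p
          simp only [shf, Pi.mul_apply]
          split_ifs <;> simp
        rw [this]
        exact S.shf _ _ (ih _ hS')
      · have : shf x h * shf y h' = 0 := by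
          funext p
          simp only [shf, Pi.mul_apply, Pi.zero_apply]
          split_ifs with h1 h2
          · exact (hxy (h1.symm.trans h2)).elim
          all_goals simp
        rw [this]
        exact S_zero

theorem S_neg {h : X A → ℤ} (hh : S A h) : S A (-h) := by
  have := S_pull_mul hh (-1) (neg_mem (one_mem _))
  simpa using this

def T (x : G) (h : X A → ℤ) : X A → ℤ :=
  fun p => if hx : A x p.hd = true then h (X.cons x p hx) else 0

theorem S_T (x : G) {h : X A → ℤ} (hh : S A h) : S A (T x h) := by
  induction hh with
  | pull g hg =>
    have : T x (pull A g) = pull A ((fun _ => g x) * rhoZ A x) := by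
      funext p
      by_cases hx : A x p.hd = true <;> simp [T, pull, rhoZ, hx, X.hd_cons]
    rw [this]
    exact S.pull _ (mul_mem (const_mem _) (rho_mem _))
  | add h h' _ _ ih ih' =>
    have : T x (h + h') = T x h + T x h' := by
      funext p
      by_cases hx : A x p.hd = true <;> simp [T, hx]
    rw [this]
    exact S.add _ _ ih ih'
  | shf y h hS _ =>
    by_cases hxy : x = y
    · have : T x (shf y h) = pull A (rhoZ A x) * h := by
        funext p
        by_cases hx : A x p.hd = true <;>
          simp [T, shf, pull, rhoZ, X.hd_cons, X.tl_cons, hxy]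
      rw [this]
      exact S_pull_mul hS _ (rho_mem _)
    · have : T x (shf y h) = 0 := by
        funext p
        by_cases hx : A x p.hd = true <;> simp [T, shf, hx, X.hd_cons, hxy]
      rw [this]
      exact S_zero

theorem S_ind (w : List (G × Bool)) :
    S A (fun p => if (run w p).isSome = true then 1 else 0) := by
  induction w with
  | nil => exact S_one
  | cons s w ih =>
    obtain ⟨x, b⟩ := s
    cases b
    · convert S_T x ih using 1
      funext p
      by_cases hx : A x p.hd = true <;> simp [run, step, T, hx]
    · convert S.shf x _ ih using 1
      funext p
      by_cases hx : p.hd = x <;> simp [run, step, shf, hx]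

theorem S_cont {F : (FreeGroup G → Bool) → ℤ} (hF : Continuous fun ξ : OmegaT A => F ξ) :
    S A fun p => F (xi p) := by
  obtain ⟨s, hs⟩ := exists_dep hF
  have h1 := mem_closure_ind (fun (ω : FreeGroup G) (p : X A) => xi p ω) s (fun p => F (xi p))
    (fun p q h => hs _ (xi_mem p) _ (xi_mem q) h)
  generalize (fun p => F (xi p)) = k at h1 ⊢
  induction h1 using Subring.closure_induction with
  | mem h hh => obtain ⟨ω, rfl⟩ := hh; exact S_ind ω.toWord
  | zero => exact S_zero
  | one => exact S_one
  | add a b _ _ ha hb => exact S.add _ _ ha hb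
  | neg a _ ha => exact S_neg ha
  | mul a b _ _ ha hb => exact S_mul ha _ hb

def res (A : G → G → Bool) : C(OmegaT A, ℤ) →+* (X A → ℤ) where
  toFun c p := c (pt p)
  map_one' := rfl
  map_mul' _ _ := rfl
  map_zero' := rfl
  map_add' _ _ := rfl

theorem res_injective : Function.Injective (res A) := by
  intro c c' h
  apply DFunLike.coe_injective
  exact denseRange_pt.equalizer c.continuous c'.continuous h

theorem continuous_ite_coord (ω : FreeGroup G) :
    Continuous fun ξ : OmegaT A => if ξ.1 ω = true then (1 : ℤ) else 0 :=
  (continuous_of_discreteTopology (f := fun b : Bool => if b = true then (1 : ℤ) else 0)).comp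
    ((continuous_apply ω).comp continuous_subtype_val)

theorem exists_res_pull {g : G → ℤ} (hg : g ∈ frakRtA A) : ∃ c, res A c = pull A g := by
  suffices h : frakRtA A ≤ (res A).range.comap (pull A) from h hg
  unfold frakRtA
  rw [Subring.closure_le]
  rintro _ (⟨x, rfl⟩ | ⟨x, rfl⟩)
  · refine ⟨⟨_, continuous_ite_coord (FreeGroup.of x)⁻¹⟩, ?_⟩
    funext p
    simp only [res, pull, RingHom.coe_mk, MonoidHom.coe_mk, OneHom.coe_mk,
      ContinuousMap.coe_mk, pt, xi_of_inv, rhoZ]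
  · refine ⟨⟨_, continuous_ite_coord (FreeGroup.of x)⟩, ?_⟩
    funext p
    simp only [res, pull, RingHom.coe_mk, MonoidHom.coe_mk, OneHom.coe_mk,
      ContinuousMap.coe_mk, pt, xi_of, delZ]

/-- Extension by zero. -/
def ext0 (c : C(OmegaT A, ℤ)) : (FreeGroup G → Bool) → ℤ := by
  classical
  exact fun ξ => if h : ξ ∈ OmegaT A then c ⟨ξ, h⟩ else 0

theorem ext0_val (c : C(OmegaT A, ℤ)) (ξ : OmegaT A) : ext0 c ξ.1 = c ξ := by
  simp [ext0]

theorem ext0_xi (c : C(OmegaT A, ℤ)) (p : X A) : ext0 c (xi p) = res A c p := ext0_val c (pt p)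

theorem continuous_ext0 (c : C(OmegaT A, ℤ)) : Continuous fun ξ : OmegaT A => ext0 c ξ.1 := by
  simp only [ext0_val]
  exact c.continuous

theorem exists_shf {h : X A → ℤ} (x : G) (hh : ∃ c, res A c = h) :
    ∃ c, res A c = shf x h ∧ ∀ ξ : OmegaT A, ξ.1 (FreeGroup.of x) ≠ true → c ξ = 0 := by
  obtain ⟨c, rfl⟩ := hh
  refine ⟨⟨_, continuous_Lterm (a := FreeGroup.of x) (continuous_ext0 c)⟩, ?_, ?_⟩
  · funext p
    simp only [res, RingHom.coe_mk, MonoidHom.coe_mk, OneHom.coe_mk, ContinuousMap.coe_mk, pt,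
      xi_of, shf]
    split_ifs with hx
    · have : sh (FreeGroup.of x) (xi p) = xi p.tl :=
        funext fun ω => xi_mul (D_of.2 ⟨hx, rfl⟩)
      rw [this, ext0_xi]
      rfl
    · rfl
  · intro ξ hξ
    simp only [ContinuousMap.coe_mk]
    rw [if_neg hξ]

theorem S_ext {h : X A → ℤ} (hh : S A h) : ∃ c, res A c = h := by
  induction hh with
  | pull g hg => exact exists_res_pull hg
  | add h h' _ _ ih ih' =>
    obtain ⟨c, rfl⟩ := ih
    obtain ⟨c', rfl⟩ := ih'
    exact ⟨c + c', map_add _ _ _⟩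
  | shf x h _ ih =>
    obtain ⟨c, hc, _⟩ := exists_shf x ih
    exact ⟨c, hc⟩

def imL (A : G → G → Bool) : AddSubgroup C(OmegaT A, ℤ) :=
  AddSubgroup.closure
          {g : C(OmegaT A, ℤ) | ∃ f : G → (FreeGroup G → Bool) → ℤ,
            MemDirectSum A f ∧
            ∀ ξ : OmegaT A, g ξ = Lalpha f (ξ : FreeGroup G → Bool)}

theorem exists_of_mem_imL {g : C(OmegaT A, ℤ)} (hg : g ∈ imL A) :
    ∃ f : G → (FreeGroup G → Bool) → ℤ,
      MemDirectSum A f ∧ ∀ ξ : OmegaT A, g ξ = Lalpha f (ξ : FreeGroup G → Bool) := by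
  classical
  unfold imL at hg
  induction hg using AddSubgroup.closure_induction with
  | mem g hg => exact hg
  | zero =>
    refine ⟨0, ⟨by simp, fun _ _ _ => rfl, fun _ => continuous_const⟩, fun ξ => ?_⟩
    simp [Lalpha]
  | add g g' _ _ h h' =>
    obtain ⟨f, hf, hL⟩ := h
    obtain ⟨f', hf', hL'⟩ := h'
    refine ⟨f + f', ⟨?_, ?_, ?_⟩, ?_⟩
    · refine (hf.1.union hf'.1).subset fun x hx => ?_
      by_contra h
      simp only [Set.mem_union, Set.mem_ofPred_eq, not_or, not_not] at h
      apply hx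
      simp [h.1, h.2]
    · intro x ξ h
      simp [hf.2.1 x ξ h, hf'.2.1 x ξ h]
    · exact fun x => (hf.2.2 x).add (hf'.2.2 x)
    · intro ξ
      have e1 := Lalpha_eq (f := f) (hf.1.toFinset ∪ hf'.1.toFinset)
        (fun x hx => by simp [hx]) ξ.1
      have e2 := Lalpha_eq (f := f') (hf.1.toFinset ∪ hf'.1.toFinset)
        (fun x hx => by simp [hx]) ξ.1
      have e3 := Lalpha_eq (f := f + f') (hf.1.toFinset ∪ hf'.1.toFinset)
        (fun x hx => by
          by_contra h
          simp only [Finset.mem_union, Set.Finite.mem_toFinset, Set.mem_ofPred_eq, not_or,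
            not_not] at h
          apply hx
          simp [h.1, h.2]) ξ.1
      rw [ContinuousMap.add_apply, hL, hL', e1, e2, e3, ← Finset.sum_add_distrib]
      apply Finset.sum_congr rfl
      intro x _
      simp only [Pi.add_apply]
      split_ifs <;> ring
  | neg g _ h =>
    obtain ⟨f, hf, hL⟩ := h
    refine ⟨-f, ⟨?_, ?_, ?_⟩, ?_⟩
    · refine hf.1.subset fun x hx => ?_
      intro h
      apply hx
      simp [h]
    · intro x ξ h
      simp [hf.2.1 x ξ h]
    · exact fun x => (hf.2.2 x).neg
    · intro ξ
      have e1 := Lalpha_eq (f := f) hf.1.toFinset (fun x hx => by simp [hx]) ξ.1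
      have e3 := Lalpha_eq (f := -f) hf.1.toFinset
        (fun x hx => by simpa using hx) ξ.1
      rw [ContinuousMap.neg_apply, hL, e1, e3, ← Finset.sum_neg_distrib]
      apply Finset.sum_congr rfl
      intro x _
      simp only [Pi.neg_apply]
      split_ifs <;> ring

theorem exists_imL {x : G} {c : C(OmegaT A, ℤ)}
    (hc : ∀ ξ : OmegaT A, ξ.1 (FreeGroup.of x) ≠ true → c ξ = 0) :
    ∃ d ∈ imL A, res A d = res A c - T x (res A c) := by
  classical
  let f : G → (FreeGroup G → Bool) → ℤ := fun z => if z = x then ext0 c else 0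
  have hf : MemDirectSum A f := by
    refine ⟨?_, ?_, ?_⟩
    · refine (Set.finite_singleton x).subset fun z hz => ?_
      by_contra h
      apply hz
      have h' : z ≠ x := h
      simp [f, h']
    · intro z ξ h
      by_cases hz : z = x
      · subst hz
        simp only [f, if_true]
        by_cases hξ : ξ ∈ OmegaT A
        · rw [ext0_val c ⟨ξ, hξ⟩]
          exact hc _ (h.resolve_left (not_not.2 hξ))
        · simp [ext0, hξ]
      · simp [f, hz]
    · intro z
      by_cases hz : z = x
      · subst hz
        simpa only [f, if_true] using continuous_ext0 c
      · simp only [f, hz, if_false]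
        exact continuous_const
  refine ⟨⟨_, continuous_Lalpha hf⟩, AddSubgroup.subset_closure ⟨f, hf, fun _ => rfl⟩, ?_⟩
  funext p
  change Lalpha f (xi p) = _
  rw [Lalpha_eq {x} (fun z hz => by
    by_contra h
    apply hz
    have h' : z ≠ x := by simpa using h
    simp [f, h'])]
  rw [Finset.sum_singleton]
  simp only [f, if_true, ext0_xi, Pi.sub_apply, T]
  congr 1
  by_cases h : A x p.hd = true
  · rw [if_pos (xi_of_inv.2 h), dif_pos h]
    have : sh (FreeGroup.of x)⁻¹ (xi p) = _ := xi_shift h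
    rw [this, ext0_xi]
  · rw [if_neg (fun h' => h (xi_of_inv.1 h')), dif_neg h]

def Good (A : G → G → Bool) (h : X A → ℤ) : Prop :=
  ∃ c, res A c = h ∧ ∃ g ∈ frakRtA A, ∃ c', res A c' = pull A g ∧ c - c' ∈ imL A

theorem good_mul {h : X A → ℤ} (hh : S A h) : ∀ g ∈ frakRtA A, Good A (pull A g * h) := by
  induction hh with
  | pull g' hg' =>
    intro g hg
    rw [← map_mul]
    obtain ⟨c, hc⟩ := exists_res_pull (mul_mem hg hg')
    exact ⟨c, hc, _, mul_mem hg hg', c, hc, by simp⟩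
  | add h h' _ _ ih ih' =>
    intro g hg
    rw [mul_add]
    obtain ⟨c1, h1, g1, hg1, d1, e1, f1⟩ := ih g hg
    obtain ⟨c2, h2, g2, hg2, d2, e2, f2⟩ := ih' g hg
    refine ⟨c1 + c2, by rw [map_add, h1, h2], g1 + g2, add_mem hg1 hg2, d1 + d2,
      by rw [map_add, map_add, e1, e2], ?_⟩
    rw [add_sub_add_comm]
    exact add_mem f1 f2
  | shf x h hS ih =>
    intro g hg
    rw [pull_shf]
    obtain ⟨c, hc, hc0⟩ := exists_shf x (S_ext (S_pull_mul hS _ (const_mem (g x))))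
    obtain ⟨d, hd, hd'⟩ := exists_imL hc0
    obtain ⟨c2, h2, g2, hg2, d2, e2, f2⟩ := ih _ (mul_mem (const_mem (g x)) (rho_mem x))
    have hT : T x (res A c) = res A c2 := by
      rw [hc, h2]
      funext p
      by_cases hx : A x p.hd = true <;>
        simp [T, shf, pull, rhoZ, hx, X.hd_cons, X.tl_cons]
    have hcd : c = d + c2 := by
      apply res_injective
      rw [map_add, hd', hT]
      simp
    refine ⟨c, hc, g2, hg2, d2, e2, ?_⟩
    rw [hcd, add_sub_assoc]
    exact add_mem hd f2

theorem main_iso (hA : ∀ i : G, ∃ j : G, A i j = true) :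
    Nonempty ((C(OmegaT A, ℤ) ⧸ imL A) ≃+
      (frakRtA A ⧸ AddSubgroup.closure
          {h : frakRtA A | ∃ v : G →₀ ℤ, (h : G → ℤ) = IA A v})) := by
  choose ph hph using fun g : frakRtA A => exists_res_pull g.2
  let φ : frakRtA A →+ C(OmegaT A, ℤ) := AddMonoidHom.mk' ph (by
    intro g g'
    apply res_injective
    rw [map_add, hph, hph, hph]
    rfl)
  have hφ : ∀ g, res A (φ g) = pull A g := hph
  let ψ : frakRtA A →+ C(OmegaT A, ℤ) ⧸ imL A := (QuotientAddGroup.mk' (imL A)).comp φ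
  have hsurj : Function.Surjective ψ := by
    intro q
    obtain ⟨c, rfl⟩ := QuotientAddGroup.mk_surjective q
    have h1 : S A (res A c) := by
      have := S_cont (continuous_ext0 c)
      simp only [ext0_xi] at this
      exact this
    obtain ⟨c1, hc1, g, hg, c', hc', hm⟩ := good_mul h1 1 (one_mem _)
    rw [map_one, one_mul] at hc1
    have := res_injective hc1
    subst this
    refine ⟨⟨g, hg⟩, ?_⟩
    have h2 : φ ⟨g, hg⟩ = c' := res_injective (by rw [hφ, hc'])
    change ((φ ⟨g, hg⟩ : C(OmegaT A, ℤ)) : C(OmegaT A, ℤ) ⧸ imL A) = _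
    rw [h2, QuotientAddGroup.eq, neg_add_eq_sub]
    exact hm
  have hker : ψ.ker = AddSubgroup.closure
          {h : frakRtA A | ∃ v : G →₀ ℤ, (h : G → ℤ) = IA A v} := by
    apply le_antisymm
    · intro g hg
      have h1 : φ g ∈ imL A := (QuotientAddGroup.eq_zero_iff _).1 hg
      obtain ⟨f, hf, hL⟩ := exists_of_mem_imL h1
      obtain ⟨v, _, hv⟩ := keyK hA hf g.1 (fun p => by
        have := congrFun (hφ g) p
        exact (hL (pt p)).symm.trans this)
      exact AddSubgroup.subset_closure ⟨v, hv.symm⟩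
    · rw [AddSubgroup.closure_le]
      rintro g ⟨v, hv⟩
      refine (QuotientAddGroup.eq_zero_iff _).2 (AddSubgroup.subset_closure ⟨J A v, memJ v, ?_⟩)
      have h1 : φ g = ⟨_, continuous_Lalpha (memJ v)⟩ := by
        apply res_injective
        rw [hφ]
        funext p
        change g.1 p.hd = Lalpha (J A v) (xi p)
        rw [LJ_xi, hv]
      intro ξ
      rw [h1]
      rfl
  exact ⟨(QuotientAddGroup.quotientKerEquivOfSurjective ψ hsurj).symm.trans
    (QuotientAddGroup.quotientAddEquivOfEq hker)⟩

end Aux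

end CKO

/-- (i) `v ↦ (v(x)·1_{Δ_x})_x` restricts to an isomorphism from
`ker (I - Aᵗ)` onto `ker L_α`; (ii) the cokernels `C(Ω̃_A; ℤ)/im L_α` and
`𝔯̃_A / im (I - Aᵗ)` are isomorphic. -/
theorem stmt_16 {G : Type*} [Nonempty G] [DecidableEq G]
    (A : G → G → Bool) (hA : ∀ i : G, ∃ j : G, A i j = true) :
    -- `(I - Aᵗ)` takes values in `𝔯̃_A` and `J` takes values in `⊕_{x∈G} C(Δ_x; ℤ)`
    (∀ v : G →₀ ℤ, CKO.IA A v ∈ CKO.frakRtA A) ∧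
    (∀ v : G →₀ ℤ, CKO.MemDirectSum A (CKO.J A v)) ∧
    -- (i) kernel correspondence: `J` maps `ker (I - Aᵗ)` bijectively onto `ker L_α`
    (∀ v : G →₀ ℤ,
      CKO.IA A v = 0 ↔ ∀ ξ ∈ CKO.OmegaT A, CKO.Lalpha (CKO.J A v) ξ = 0) ∧
    (∀ f : G → (FreeGroup G → Bool) → ℤ, CKO.MemDirectSum A f →
      (∀ ξ ∈ CKO.OmegaT A, CKO.Lalpha f ξ = 0) →
      ∃! v : G →₀ ℤ, CKO.IA A v = 0 ∧ f = CKO.J A v) ∧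
    -- (ii) the cokernels are isomorphic
    Nonempty
      ((C(CKO.OmegaT A, ℤ) ⧸ AddSubgroup.closure
          {g : C(CKO.OmegaT A, ℤ) | ∃ f : G → (FreeGroup G → Bool) → ℤ,
            CKO.MemDirectSum A f ∧
            ∀ ξ : CKO.OmegaT A, g ξ = CKO.Lalpha f (ξ : FreeGroup G → Bool)}) ≃+
        (CKO.frakRtA A ⧸ AddSubgroup.closure
          {h : CKO.frakRtA A | ∃ v : G →₀ ℤ, (h : G → ℤ) = CKO.IA A v})) := by
  refine ⟨CKO.IA_mem, CKO.memJ, ?_, ?_, CKO.main_iso hA⟩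
  · intro v
    constructor
    · intro h
      refine CKO.eq_of_dense (F' := fun _ => 0) (CKO.continuous_Lalpha (CKO.memJ v))
        continuous_const ?_
      intro p
      rw [CKO.LJ_xi, h]
      rfl
    · intro h
      funext j
      obtain ⟨p, rfl⟩ := CKO.exists_hd hA j
      rw [← CKO.LJ_xi, h _ (CKO.xi_mem p)]
      rfl
  · intro f hf h
    obtain ⟨v, h1, h2⟩ := CKO.keyK hA hf 0 (fun p => h _ (CKO.xi_mem p))
    refine ⟨v, ⟨h2, h1⟩, ?_⟩
    rintro w ⟨_, hw⟩
    exact CKO.J_injective hA (hw.symm.trans h1)
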